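/- For n ≥ 5, the inclusion of the alternating group A_n into the symmetric group S_n is an envelope: every homomorphism A_n → S_n extends to an endomorphism of S_n, and every endomorphism of S_n restricting to the inclusion on A_n is an automorphism of S_n. -/

import Mathlib

open Equiv Equiv.Perm

/-- A three-cycle moving `u` is the cycle `(u (g u) (g (g u)))`. -/
theorem Equiv.Perm.IsThreeCycle.eq_swap_mul_swap_same {α : Type*} [Fintype α] [DecidableEq α]
    {g : Perm α} (hg : g.IsThreeCycle) {u : α} (hu : g u ≠ u) :
    g u ≠ u ∧ g (g u) ≠ u ∧ g (g u) ≠ g u ∧ g (g (g u)) = u ∧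
      (∀ p, p ≠ u → p ≠ g u → p ≠ g (g u) → g p = p) ∧
      g = swap u (g (g u)) * swap u (g u) := by
  have hu' := mem_support.mpr hu
  have hnodup := hg.nodup_iff_mem_support.mpr hu'
  have hsupp := hg.support_eq_iff_mem_support.mpr hu'
  simp only [List.nodup_cons, List.mem_cons, List.not_mem_nil, or_false, not_or,
    List.nodup_nil, not_false_eq_true, and_true] at hnodup
  have h3 : g (g (g u)) = u := by
    have h := pow_orderOf_eq_one g
    rw [hg.orderOf] at h
    exact congr($h u)
  have hfix p (h1 : p ≠ u) (h2 : p ≠ g u) (h4 : p ≠ g (g u)) : g p = p := by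
    rw [← notMem_support, hsupp]
    simp [h1, h2, h4]
  refine ⟨hu, Ne.symm hnodup.1.2, Ne.symm hnodup.2, h3, hfix, ?_⟩
  ext p
  rw [Perm.mul_apply]
  grind

/-- If `g` and `h` are three-cycles such that `g * h` has order two, then
`g = (u v w)` and `h = (u v z)` for distinct points `u, v, w, z`. -/
theorem Equiv.Perm.IsThreeCycle.exists_eq_of_mul_sq_eq_one {α : Type*} [Fintype α] [DecidableEq α]
    {g h : Perm α} (hg : g.IsThreeCycle) (hh : h.IsThreeCycle)
    (hsq : (g * h) * (g * h) = 1) (hne : g * h ≠ 1) :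
    ∃ u v w z : α, u ≠ v ∧ w ≠ u ∧ w ≠ v ∧ z ≠ u ∧ z ≠ v ∧ z ≠ w ∧
      g = swap u w * swap u v ∧ h = swap u z * swap u v := by
  have hsq' (p : α) : g (h (g (h p))) = p := congr($hsq p)
  obtain ⟨a, ha⟩ : g.support.Nonempty := by
    rw [Finset.nonempty_iff_ne_empty, ne_eq, support_eq_empty_iff]
    exact hg.ne_one
  by_cases hsub : ∀ p, g p ≠ p → h p ≠ p
  · exfalso
    have hs : g.support = h.support :=
      Finset.eq_of_subset_of_card_le (fun p ↦ by simpa using hsub p)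
        (by rw [hg.card_support, hh.card_support])
    have ha' := mem_support.mp ha
    obtain ⟨g1, g2, g3, g4, g5, hge⟩ := hg.eq_swap_mul_swap_same ha'
    obtain ⟨h1, h2, h3, h4, h5, hhe⟩ := hh.eq_swap_mul_swap_same (hsub a ha')
    have hb : h a ∈ g.support := by simpa [hs] using h1
    have hc : h (h a) ∈ g.support := by simpa [hs] using h3
    rw [hg.support_eq_iff_mem_support.mpr ha] at hb hc
    simp only [Finset.mem_insert, Finset.mem_singleton] at hb hc
    by_cases hab : h a = g a
    · grind
    · refine hne (Perm.ext fun p ↦ ?_)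
      have e1 : h a = g (g a) := by grind
      have e2 : h (g (g a)) = g a := by grind
      have e3 : h (g a) = a := by grind
      rw [Perm.mul_apply, one_apply]
      by_cases p = a <;> by_cases p = g a <;> by_cases p = g (g a) <;> grind
  · push Not at hsub
    obtain ⟨w, hgw, hhw⟩ := hsub
    obtain ⟨g1, g2, g3, g4, g5, -⟩ := hg.eq_swap_mul_swap_same hgw
    have hhu : h (g w) = g (g w) := by
      apply g.injective
      apply h.injective
      apply g.injective
      rw [g4, hhw]
      have := hsq' (g⁻¹ (h⁻¹ (g w)))
      grind
    have hgu := (hg.eq_swap_mul_swap_same (u := g w) (by grind)).2.2.2.2.2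
    obtain ⟨h1, h2, h3, h4, h5, hhe⟩ := hh.eq_swap_mul_swap_same (u := g w) (by grind)
    refine ⟨g w, g (g w), w, h (g (g w)), ?_, ?_, ?_, ?_, ?_, ?_, ?_, ?_⟩ <;> grind

/-- A three-cycle whose products with `(u v w)` and with `(u v z)` both have order two is of
the form `(u v t)`. -/
theorem exists_eq_swap_mul_swap_of_mul_sq_eq_one {α : Type*} [Fintype α] [DecidableEq α]
    {u v w z : α} (huv : u ≠ v) (hwu : w ≠ u) (hwv : w ≠ v) (hzu : z ≠ u) (hzv : z ≠ v)
    (hzw : z ≠ w) {k : Perm α} (hk : k.IsThreeCycle)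
    (hw : (swap u w * swap u v * k) * (swap u w * swap u v * k) = 1)
    (hw1 : swap u w * swap u v * k ≠ 1)
    (hz : (swap u z * swap u v * k) * (swap u z * swap u v * k) = 1)
    (hz1 : swap u z * swap u v * k ≠ 1) :
    ∃ t, t ≠ u ∧ t ≠ v ∧ k = swap u t * swap u v := by
  suffices huk : k u = v by
    obtain ⟨h1, h2, h3, -, -, h4⟩ := hk.eq_swap_mul_swap_same (u := u) (by grind)
    exact ⟨k v, by grind, by grind, by grind⟩
  obtain ⟨a, b, c, d, hab, hca, hcb, hda, hdb, hdc, h1, h2⟩ :=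
    (isThreeCycle_swap_mul_swap_same hwu.symm huv hwv).exists_eq_of_mul_sq_eq_one hk hw hw1
  obtain ⟨a', b', c', d', hab', hca', hcb', hda', hdb', hdc', h1', h2'⟩ :=
    (isThreeCycle_swap_mul_swap_same hzu.symm huv hzv).exists_eq_of_mul_sq_eq_one hk hz hz1
  have act {p q r : α} (hpq : p ≠ q) (hrp : r ≠ p) (hrq : r ≠ q) (s : α) :
      (swap p r * swap p q) s = if s = p then q else if s = q then r else if s = r then p else s := by
    rw [Perm.mul_apply]
    grind
  have e1 s : (swap u w * swap u v) s = (swap a c * swap a b) s := congr($h1 s)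
  have e2 s : k s = (swap a d * swap a b) s := congr($h2 s)
  have e1' s : (swap u z * swap u v) s = (swap a' c' * swap a' b') s := congr($h1' s)
  have e2' s : k s = (swap a' d' * swap a' b') s := congr($h2' s)
  simp only [act huv hwu hwv, act huv hzu hzv, act hab hca hcb, act hab hda hdb,
    act hab' hca' hcb', act hab' hda' hdb'] at e1 e2 e1' e2'
  have := e1 a
  have := e1 b
  have := e1' a'
  have := e1' b'
  have := e2 a
  have := e2' a
  have := e2 a'
  have := e2' a'
  have := e2 u
  have := e2' u
  have := e2 v
  have := e2' v
  clear e1 e1' e2 e2' h1 h2 h1' h2' act hw hw1 hz hz1 hk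
  grind (splits := 20)

/-- The three-cycles `(x y c)` with `x` and `y` fixed generate the alternating group. -/
theorem alternatingGroup_le_of_swap_mul_swap_mem {α : Type*} [Fintype α] [DecidableEq α]
    {x y : α} (hxy : x ≠ y) {H : Subgroup (Perm α)}
    (hH : ∀ c, c ≠ x → c ≠ y → swap x c * swap x y ∈ H) : alternatingGroup α ≤ H := by
  let G := H ⊓ alternatingGroup α
  have hG (c : α) (hcx : c ≠ x) (hcy : c ≠ y) : swap x c * swap x y ∈ G :=
    ⟨hH c hcx hcy, (isThreeCycle_swap_mul_swap_same hcx.symm hxy hcy).mem_alternatingGroup⟩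
  have hG' (c : α) (hc : c ≠ x) : swap x c * swap x y ∈ G := by
    by_cases hcy : c = y
    · simp [hcy, G.one_mem]
    · exact hG c hc hcy
  have step (σ : Perm α) (c : α) (hc : c ≠ x) (h : σ ∈ G ∨ σ * swap x y ∈ G) :
      σ * swap x c ∈ G ∨ σ * swap x c * swap x y ∈ G := by
    rcases h with h | h
    · right
      simpa [mul_assoc] using G.mul_mem h (hG' c hc)
    · left
      simpa [mul_assoc] using G.mul_mem h (G.inv_mem (hG' c hc))
  have key (σ : Perm α) : σ ∈ G ∨ σ * swap x y ∈ G := by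
    induction σ using swap_induction_on' with
    | one => exact .inl G.one_mem
    | mul_swap σ a b hab ih =>
      by_cases ha : a = x
      · subst ha
        exact step σ b hab.symm ih
      by_cases hb : b = x
      · subst hb
        rw [swap_comm]
        exact step σ a ha ih
      have : swap a b = swap x a * swap x b * swap x a := by
        have := swap_apply_apply (swap x a) x b
        rw [swap_apply_left, swap_apply_of_ne_of_ne hb hab.symm, swap_inv] at this
        exact this
      rw [this, ← mul_assoc, ← mul_assoc]
      exact step _ _ ha (step _ _ hb (step _ _ ha ih))
  intro σ hσ
  refine (key σ).elim (·.1) fun h ↦ ?_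
  have h' := mem_alternatingGroup.mp h.2
  rw [Perm.sign_mul, mem_alternatingGroup.mp hσ, sign_swap hxy] at h'
  cases h'

/-- The alternating group has trivial centralizer in the symmetric group. -/
theorem eq_one_of_forall_commute_alternatingGroup {α : Type*} [Fintype α] [DecidableEq α]
    (hα : 4 ≤ Fintype.card α) {z : Perm α} (hz : ∀ a ∈ alternatingGroup α, Commute z a) :
    z = 1 := by
  ext x
  by_contra hx
  rw [one_apply] at hx
  obtain ⟨c, hc⟩ := Finset.exists_mem_notMem_of_card_lt_card
    (s := {x, z x}) (t := Finset.univ) (by grind [Finset.card_le_two, Finset.card_univ])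
  obtain ⟨d, hd⟩ := Finset.exists_mem_notMem_of_card_lt_card
    (s := {x, z x, c}) (t := Finset.univ) (by grind [Finset.card_le_three, Finset.card_univ])
  simp only [Finset.mem_univ, Finset.mem_insert, Finset.mem_singleton, not_or, true_and] at hc hd
  have h := hz (swap (z x) c * swap (z x) d)
    (isThreeCycle_swap_mul_swap_same (Ne.symm hc.2) (Ne.symm hd.2.1) (Ne.symm hd.2.2)).mem_alternatingGroup
  have := congr($(h.eq) x)
  simp only [Perm.mul_apply] at this
  grind

/-- A three-cycle-preserving injective homomorphism on the alternating group is conjugation by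
a permutation. -/
theorem exists_conj_of_map_isThreeCycle {α : Type*} [Fintype α] [DecidableEq α]
    (hα : 4 ≤ Fintype.card α) (β : alternatingGroup α →* Perm α) (hβ : Function.Injective β)
    (h3 : ∀ a : alternatingGroup α, (a : Perm α).IsThreeCycle → (β a).IsThreeCycle) :
    ∃ τ : Perm α, ∀ a, β a = τ * a * τ⁻¹ := by
  obtain ⟨x, y, hxy⟩ := Fintype.exists_pair_of_one_lt_card (α := α) (by lia)
  obtain ⟨c, hc⟩ := Finset.exists_mem_notMem_of_card_lt_card
    (s := {x, y}) (t := Finset.univ) (by grind [Finset.card_le_two, Finset.card_univ])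
  obtain ⟨d, hd⟩ := Finset.exists_mem_notMem_of_card_lt_card
    (s := {x, y, c}) (t := Finset.univ) (by grind [Finset.card_le_three, Finset.card_univ])
  simp only [Finset.mem_univ, Finset.mem_insert, Finset.mem_singleton, not_or, true_and] at hc hd
  have hdxy : d ≠ x ∧ d ≠ y := ⟨hd.1, hd.2.1⟩
  let t (e : α) (he : e ≠ x ∧ e ≠ y) : alternatingGroup α :=
    ⟨swap x e * swap x y,
      (isThreeCycle_swap_mul_swap_same he.1.symm hxy he.2).mem_alternatingGroup⟩
  have ht3 e he : (β (t e he)).IsThreeCycle :=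
    h3 _ (isThreeCycle_swap_mul_swap_same he.1.symm hxy he.2)
  have htinj e he e' he' (h : t e he = t e' he') : e = e' := by
    have := congr(($h : Perm α) y)
    simpa [t] using this
  have hsq e he e' he' (hne : e ≠ e') :
      (β (t e he) * β (t e' he')) * (β (t e he) * β (t e' he')) = 1 := by
    simp only [← map_mul]
    rw [show t e he * t e' he' * (t e he * t e' he') = 1 from ?_, map_one]
    ext p
    simp only [t, Subgroup.coe_mul, Perm.mul_apply, Subgroup.coe_one, one_apply]
    clear ht3 htinj h3
    grind (splits := 20)
  have hne1 e he e' he' (hne : e ≠ e') : β (t e he) * β (t e' he') ≠ 1 := by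
    rw [← map_mul, ne_eq, map_eq_one_iff β hβ]
    intro h
    have := congr(($h : Perm α) x)
    simp only [t, Subgroup.coe_mul, Perm.mul_apply, Subgroup.coe_one, one_apply] at this
    grind
  obtain ⟨u, v, w, z, huv, hwu, hwv, hzu, hzv, hzw, hgw, hgz⟩ :=
    (ht3 c hc).exists_eq_of_mul_sq_eq_one (ht3 d hdxy)
      (hsq c hc d hdxy (Ne.symm hd.2.2)) (hne1 c hc d hdxy (Ne.symm hd.2.2))
  have hφ e : ∃ p, ∀ he : e ≠ x ∧ e ≠ y, p ≠ u ∧ p ≠ v ∧ β (t e he) = swap u p * swap u v := by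
    by_cases he : e ≠ x ∧ e ≠ y
    · by_cases hec : e = c
      · subst hec
        exact ⟨w, fun _ ↦ ⟨hwu, hwv, hgw⟩⟩
      by_cases hed : e = d
      · subst hed
        exact ⟨z, fun _ ↦ ⟨hzu, hzv, hgz⟩⟩
      obtain ⟨p, hp⟩ := exists_eq_swap_mul_swap_of_mul_sq_eq_one huv hwu hwv hzu hzv hzw (ht3 e he)
        (hgw ▸ hsq c hc e he (Ne.symm hec)) (hgw ▸ hne1 c hc e he (Ne.symm hec))
        (hgz ▸ hsq d hdxy e he (Ne.symm hed)) (hgz ▸ hne1 d hdxy e he (Ne.symm hed))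
      exact ⟨p, fun _ ↦ hp⟩
    · exact ⟨u, fun h ↦ absurd h he⟩
  choose φ hφ using hφ
  let τ₀ (e : α) : α := if e = x then u else if e = y then v else φ e
  have hτ₀ : Function.Injective τ₀ := by
    have hφinj e he e' he' (h : φ e = φ e') : e = e' :=
      htinj e he e' he' (hβ (by rw [(hφ e he).2.2, (hφ e' he').2.2, h]))
    intro e e' h
    simp only [τ₀] at h
    grind
  let τ : Perm α := Equiv.ofBijective τ₀ (Finite.injective_iff_bijective.mp hτ₀)
  have hτx : τ x = u := by simp [τ, τ₀]
  have hτy : τ y = v := by simp [τ, τ₀, hxy.symm]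
  have hτ e (he : e ≠ x ∧ e ≠ y) : τ e = φ e := by simp [τ, τ₀, he]
  have hle := alternatingGroup_le_of_swap_mul_swap_mem hxy
    (H := (β.eqLocus ((MulAut.conj τ).toMonoidHom.comp (alternatingGroup α).subtype)).map
      (alternatingGroup α).subtype) fun e hex hey ↦ by
    refine ⟨t e ⟨hex, hey⟩, ?_, rfl⟩
    change β (t e ⟨hex, hey⟩) = τ * (swap x e * swap x y) * τ⁻¹
    rw [(hφ e ⟨hex, hey⟩).2.2, ← hτ e ⟨hex, hey⟩, ← hτx, ← hτy, swap_apply_apply, swap_apply_apply]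
    group
  refine ⟨τ, fun a ↦ ?_⟩
  obtain ⟨b, hb, hba⟩ := hle a.2
  obtain rfl : b = a := Subtype.ext hba
  exact hb

/-- The conjugacy class in the symmetric group of an element of order three of the
alternating group does not split in the alternating group. -/
theorem exists_mem_alternatingGroup_conj_eq {α : Type*} [Fintype α] [DecidableEq α]
    (hα : 5 ≤ Fintype.card α) {g : Perm α} (hg : orderOf g = 3) (σ : Perm α) :
    ∃ ρ ∈ alternatingGroup α, σ * g * σ⁻¹ = ρ * g * ρ⁻¹ := by
  by_cases hσ : σ ∈ alternatingGroup α
  · exact ⟨σ, hσ, rfl⟩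
  obtain ⟨z, hz, hzA⟩ : ∃ z ∈ Subgroup.centralizer {g}, z ∉ alternatingGroup α := by
    by_contra! h
    obtain ⟨-, hcard, hcount⟩ := centralizer_le_alternating_iff.mp h
    obtain ⟨n, hn⟩ := cycleType_prime_order (hg ▸ Nat.prime_three)
    rw [hg] at hn
    have := hcount 3
    rw [hn, Multiset.count_replicate_self] at this
    obtain rfl : n = 0 := by lia
    simp [hn] at hcard
    lia
  refine ⟨σ * z, ?_, ?_⟩
  · rw [mem_alternatingGroup] at *
    rw [Perm.sign_mul, (Int.units_eq_one_or _).resolve_left hσ, (Int.units_eq_one_or _).resolve_left hzA]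
    rfl
  · rw [Subgroup.mem_centralizer_singleton_iff] at hz
    rw [mul_assoc σ z g, hz]
    group

/-- Every injective homomorphism from the alternating group to the symmetric group extends. -/
theorem exists_extension_of_injective {α : Type*} [Fintype α] [DecidableEq α]
    (hα : 5 ≤ Fintype.card α) (ψ : alternatingGroup α →* Perm α) (hψ : Function.Injective ψ) :
    ∃ f : Perm α →* Perm α, f.comp (alternatingGroup α).subtype = ψ := by
  have : Nontrivial α := Fintype.one_lt_card_iff_nontrivial.mp (by lia)
  have hrange : ψ.range = alternatingGroup α := by
    apply eq_alternatingGroup_of_index_eq_two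
    have h1 := ψ.range.index_mul_card
    have h2 := two_mul_nat_card_alternatingGroup (α := α)
    rw [← Nat.card_congr (MonoidHom.ofInjective hψ).toEquiv, ← h2] at h1
    exact Nat.eq_of_mul_eq_mul_right Nat.card_pos h1
  let e : alternatingGroup α ≃* alternatingGroup α :=
    (MonoidHom.ofInjective hψ).trans (MulEquiv.subgroupCongr hrange)
  have he a : (e a : Perm α) = ψ a := rfl
  have hconj (σ : Perm α) : ∃ τ : Perm α, ∀ a : alternatingGroup α,
      ψ (MulAut.conjNormal σ a) = τ * ψ a * τ⁻¹ := by
    obtain ⟨τ, hτ⟩ := exists_conj_of_map_isThreeCycle (by lia)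
      (ψ.comp ((MulAut.conjNormal σ).toMonoidHom.comp e.symm.toMonoidHom))
      (hψ.comp ((MulAut.conjNormal σ).injective.comp e.symm.injective)) (fun k hk ↦ by
        have hord : orderOf (e.symm k : Perm α) = 3 := by
          rw [Subgroup.orderOf_coe, MulEquiv.orderOf_eq, ← Subgroup.orderOf_coe, hk.orderOf]
        obtain ⟨ρ, hρ, h⟩ := exists_mem_alternatingGroup_conj_eq hα hord σ
        have h' : MulAut.conjNormal σ (e.symm k) = ⟨ρ, hρ⟩ * e.symm k * ⟨ρ, hρ⟩⁻¹ :=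
          Subtype.ext h
        change (ψ (MulAut.conjNormal σ (e.symm k))).IsThreeCycle
        rw [h', map_mul, map_mul, map_inv, ← he (e.symm k), e.apply_symm_apply, IsThreeCycle,
          cycleType_conj]
        exact hk)
    refine ⟨τ, fun a ↦ ?_⟩
    have := hτ (e a)
    rw [he] at this
    rw [← this]
    simp
  have huniq (τ τ' : Perm α) (h : ∀ a, τ * ψ a * τ⁻¹ = τ' * ψ a * τ'⁻¹) : τ = τ' := by
    rw [eq_comm, ← inv_mul_eq_one]
    refine eq_one_of_forall_commute_alternatingGroup (by lia) fun b hb ↦ ?_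
    obtain ⟨a, rfl⟩ := hrange.symm ▸ hb
    calc τ'⁻¹ * τ * ψ a = τ'⁻¹ * (τ * ψ a * τ⁻¹) * τ := by group
      _ = ψ a * (τ'⁻¹ * τ) := by rw [h]; group
  choose f hf using hconj
  refine ⟨MonoidHom.mk' f fun σ τ ↦ huniq _ _ fun a ↦ ?_, ?_⟩
  · rw [← hf, map_mul, MulAut.mul_apply, hf, hf]
    group
  · ext1 a
    refine huniq _ _ fun b ↦ ?_
    change f a * ψ b * (f a)⁻¹ = _
    rw [← hf, ← map_inv, ← map_mul, ← map_mul]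
    rfl

/-- for n ≥ 5, the inclusion A_n ↪ S_n is an envelope: every
homomorphism A_n → S_n extends to an endomorphism of S_n, and every endomorphism
of S_n restricting to the inclusion on A_n is an automorphism of S_n. -/
theorem alternating_in_symmetric_is_envelope (n : ℕ) (hn : 5 ≤ n) :
    Function.Surjective
      (fun f : Equiv.Perm (Fin n) →* Equiv.Perm (Fin n) =>
        f.comp (alternatingGroup (Fin n)).subtype) ∧
    (∀ f : Equiv.Perm (Fin n) →* Equiv.Perm (Fin n),
      f.comp (alternatingGroup (Fin n)).subtype = (alternatingGroup (Fin n)).subtype →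
      Function.Bijective f) := by
  have hcard : 5 ≤ Fintype.card (Fin n) := by simp [hn]
  refine ⟨fun ψ ↦ ?_, fun f hf ↦ ?_⟩
  · have := alternatingGroup.isSimpleGroup (α := Fin n) (by simpa using hn)
    rcases ψ.normal_ker.eq_bot_or_eq_top with h | h
    · exact exists_extension_of_injective hcard ψ ((MonoidHom.ker_eq_bot_iff ψ).mp h)
    · refine ⟨1, ?_⟩
      ext1 a
      have ha : a ∈ ψ.ker := h ▸ Subgroup.mem_top a
      exact ((MonoidHom.mem_ker).mp ha).symm
  · have hfA (a : Perm (Fin n)) (ha : a ∈ alternatingGroup (Fin n)) : f a = a :=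
      DFunLike.congr_fun hf ⟨a, ha⟩
    suffices f = MonoidHom.id _ by simp [this]
    ext1 σ
    rw [MonoidHom.id_apply, eq_comm, ← inv_mul_eq_one]
    refine eq_one_of_forall_commute_alternatingGroup (by lia) fun a ha ↦ ?_
    have h := hfA (σ * a * σ⁻¹) (alternatingGroup.normal.conj_mem a ha σ)
    rw [map_mul, map_mul, map_inv, hfA a ha] at h
    calc σ⁻¹ * f σ * a = σ⁻¹ * (f σ * a * (f σ)⁻¹) * f σ := by group
      _ = a * (σ⁻¹ * f σ) := by rw [h]; group
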